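/- (Gelfand theorem for quaternion B*-algebras) Let A be an ℍ-B*-algebra in which every element is normal, i.e. a* a = a a* for all a ∈ A. Then there exist a locally compact Hausdorff space Ω and a bijective isometric ℝ-algebra homomorphism Φ : A → C₀(Ω, ℍ) (continuous ℍ-valued functions vanishing at infinity, with pointwise operations, pointwise star, and sup norm) such that Φ(a*) = (Φ(a))* and Φ(α • a • β) = α · Φ(a) · β (pointwise quaternion multiplication) for all a ∈ A and α, β ∈ ℍ. -/

import Mathlib

open MulOpposite ZeroAtInfty

local notation "ℍ" => Quaternion ℝ

section Gelfand

open Filter Topology WeakDual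

/-- A continuous function on a compact Hausdorff space vanishing at `p` vanishes at infinity on
the complement of `p`. -/
theorem ContinuousMap.tendsto_cocompact_compl_singleton {X : Type*} [TopologicalSpace X]
    [CompactSpace X] [T2Space X] (p : X) (f : C(X, ℂ)) (hf : f p = 0) :
    Tendsto (fun x : ({p}ᶜ : Set X) => f x) (cocompact _) (𝓝 0) := by
  have hemb : IsEmbedding (Subtype.val : ({p}ᶜ : Set X) → X) := IsEmbedding.subtypeVal
  have _ : LocallyCompactSpace ({p}ᶜ : Set X) := isOpen_compl_singleton.locallyCompactSpace
  let e := OnePoint.equivOfIsEmbeddingOfRangeEq p _ hemb Subtype.range_val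
  have h := ((OnePoint.continuous_iff _).1 (f.continuous.comp e.continuous)).1
  rw [coclosedCompact_eq_cocompact] at h
  simpa [e, hf] using h

/-- A function vanishing at infinity on the complement of a point `p` of a compact Hausdorff space
extends continuously by `0` at `p`. -/
theorem ZeroAtInftyContinuousMap.exists_extension_compl_singleton {X : Type*} [TopologicalSpace X]
    [CompactSpace X] [T2Space X] (p : X) (g : C₀(({p}ᶜ : Set X), ℂ)) :
    ∃ f : C(X, ℂ), f p = 0 ∧ ∀ x : ({p}ᶜ : Set X), f x = g x := by
  have hemb : IsEmbedding (Subtype.val : ({p}ᶜ : Set X) → X) := IsEmbedding.subtypeVal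
  have _ : LocallyCompactSpace ({p}ᶜ : Set X) := isOpen_compl_singleton.locallyCompactSpace
  let e := OnePoint.equivOfIsEmbeddingOfRangeEq p _ hemb Subtype.range_val
  have h : Tendsto g (coclosedCompact _) (𝓝 0) := by
    rw [coclosedCompact_eq_cocompact]
    exact g.zero_at_infty'
  let F := OnePoint.continuousMapMk (g : C(({p}ᶜ : Set X), ℂ)) 0 h
  refine ⟨F.comp ⟨e.symm, e.symm.continuous⟩, ?_, fun x => ?_⟩
  · have : e.symm p = OnePoint.infty := by
      rw [Homeomorph.symm_apply_eq]; rfl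
    simp only [ContinuousMap.comp_apply, ContinuousMap.coe_mk, this]
    rfl
  · have : e.symm (x : X) = (x : OnePoint ({p}ᶜ : Set X)) := by
      rw [Homeomorph.symm_apply_eq]; rfl
    simp only [ContinuousMap.comp_apply, ContinuousMap.coe_mk, this]
    rfl

namespace ZeroAtInftyContinuousMap

variable {Ω β γ : Type*} [TopologicalSpace Ω]

/-- Postcomposition of a function vanishing at infinity with a continuous map fixing `0`. -/
def postcomp [TopologicalSpace β] [Zero β] [TopologicalSpace γ] [Zero γ] (g : C(β, γ))
    (hg : g 0 = 0) (f : C₀(Ω, β)) : C₀(Ω, γ) where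
  toFun ω := g (f ω)
  continuous_toFun := g.continuous.comp f.continuous
  zero_at_infty' := by
    have h := (g.continuous.tendsto 0).comp (zero_at_infty f)
    rwa [hg] at h

variable [NormedAddCommGroup β] [NormedAddCommGroup γ]

theorem norm_le_norm_of_forall {f : C₀(Ω, β)} {g : C₀(Ω, γ)} (h : ∀ ω, ‖f ω‖ ≤ ‖g ω‖) :
    ‖f‖ ≤ ‖g‖ := by
  rw [← norm_toBCF_eq_norm, ← norm_toBCF_eq_norm]
  exact (BoundedContinuousFunction.norm_le (norm_nonneg _)).2 fun ω =>
    (h ω).trans (g.toBCF.norm_coe_le_norm ω)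

theorem norm_eq_norm_of_forall {f : C₀(Ω, β)} {g : C₀(Ω, γ)} (h : ∀ ω, ‖f ω‖ = ‖g ω‖) :
    ‖f‖ = ‖g‖ :=
  le_antisymm (norm_le_norm_of_forall fun ω => (h ω).le)
    (norm_le_norm_of_forall fun ω => (h ω).ge)

end ZeroAtInftyContinuousMap

/-- **Gelfand duality** for non-unital commutative complex C⋆-algebras. -/
theorem NonUnitalCommCStarAlgebra.exists_gelfand_isometry.{u} (B : Type u)
    [NonUnitalCommCStarAlgebra B] :
    ∃ (Ω : Type u) (_ : TopologicalSpace Ω) (_ : LocallyCompactSpace Ω) (_ : T2Space Ω)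
      (Ψ : B →⋆ₙₐ[ℂ] C₀(Ω, ℂ)), Function.Surjective Ψ ∧ ∀ b, ‖Ψ b‖ = ‖b‖ := by
  let U := Unitization ℂ B
  let K := characterSpace ℂ U
  let p : K := CharacterSpace.equivAlgHom.symm (Unitization.fstHom ℂ B)
  have hp (u : U) : p u = u.fst := rfl
  let G := gelfandStarTransform U
  have hG (u : U) (χ : K) : G u χ = χ u := rfl
  let Ψ : B →⋆ₙₐ[ℂ] C₀(({p}ᶜ : Set K), ℂ) :=
    { toFun := fun b =>
        { toFun := fun χ => G b χ
          continuous_toFun := by fun_prop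
          zero_at_infty' :=
            (G b).tendsto_cocompact_compl_singleton p (by rw [hG, hp, Unitization.fst_inr]) }
      map_smul' := fun z b => by ext χ; simp [hG]
      map_zero' := by ext χ; simp
      map_add' := fun b c => by ext χ; simp [hG]
      map_mul' := fun b c => by ext χ; simp [hG]
      map_star' := fun b => by
        ext χ
        change G ((star b : B) : U) χ = star (G b χ)
        rw [Unitization.inr_star, map_star, ContinuousMap.star_apply] }
  have hΨ (b : B) (χ : ({p}ᶜ : Set K)) : Ψ b χ = G b χ := rfl
  refine ⟨({p}ᶜ : Set K), inferInstance, isOpen_compl_singleton.locallyCompactSpace,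
    inferInstance, Ψ, fun g => ?_, fun b => ?_⟩
  · obtain ⟨f, hf0, hf⟩ := g.exists_extension_compl_singleton p
    obtain ⟨u, hu : G u = f⟩ := G.surjective f
    have hu0 : u.fst = 0 := by rw [← hp, ← hG, hu, hf0]
    have hu' : ((u.snd : B) : U) = u := by ext <;> simp [hu0]
    refine ⟨u.snd, ?_⟩
    ext χ
    rw [hΨ, hu', hu, hf]
  · have h1 : ‖G b‖ = ‖b‖ := by
      rw [← Unitization.norm_inr (𝕜 := ℂ) b]
      exact (gelfandTransform_isometry U).norm_map_of_map_zero (map_zero _) _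
    rw [← h1, ← ZeroAtInftyContinuousMap.norm_toBCF_eq_norm]
    refine le_antisymm ((BoundedContinuousFunction.norm_le (norm_nonneg _)).2 fun χ =>
      (G b).norm_coe_le_norm χ) ((ContinuousMap.norm_le _ (norm_nonneg _)).2 fun χ => ?_)
    by_cases hχ : χ = p
    · rw [hχ, hG, hp]; simp
    · exact (Ψ b).toBCF.norm_coe_le_norm ⟨χ, hχ⟩

end Gelfand

/-- An `ℍ`-B⋆-algebra all of whose elements are normal. -/
class IsNormalQuaternionBStarAlgebra (A : Type*) [NonUnitalNormedRing A] [StarRing A]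
    [Module ℍ A] [Module ℍᵐᵒᵖ A] : Prop where
  norm_smul_op_smul_le : ∀ (α β : ℍ) (a : A), ‖α • op β • a‖ ≤ ‖α‖ * ‖a‖ * ‖β‖
  quat_smul_mul : ∀ (γ : ℍ) (a b : A), (γ • a) * b = γ • (a * b)
  op_quat_smul_mul : ∀ (γ : ℍ) (a b : A), (op γ • a) * b = a * (γ • b)
  op_quat_smul_mul' : ∀ (γ : ℍ) (a b : A), op γ • (a * b) = a * (op γ • b)
  star_quat_smul : ∀ (α : ℍ) (b : A), star (α • b) = op (star α) • (star b)
  star_op_quat_smul : ∀ (α : ℍ) (b : A), star (op α • b) = (star α) • (star b)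
  star_mul_self_comm : ∀ a : A, star a * a = a * star a

namespace QuaternionBStar

/-- The quaternion unit `i`. -/
noncomputable def qi : ℍ := ⟨0, 1, 0, 0⟩

/-- The quaternion unit `j`. -/
noncomputable def qj : ℍ := ⟨0, 0, 1, 0⟩

/-- The quaternion unit `k`. -/
noncomputable def qk : ℍ := ⟨0, 0, 0, 1⟩

@[simp] theorem re_qi : qi.re = 0 := rfl
@[simp] theorem imI_qi : qi.imI = 1 := rfl
@[simp] theorem imJ_qi : qi.imJ = 0 := rfl
@[simp] theorem imK_qi : qi.imK = 0 := rfl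
@[simp] theorem re_qj : qj.re = 0 := rfl
@[simp] theorem imI_qj : qj.imI = 0 := rfl
@[simp] theorem imJ_qj : qj.imJ = 1 := rfl
@[simp] theorem imK_qj : qj.imK = 0 := rfl
@[simp] theorem re_qk : qk.re = 0 := rfl
@[simp] theorem imI_qk : qk.imI = 0 := rfl
@[simp] theorem imJ_qk : qk.imJ = 0 := rfl
@[simp] theorem imK_qk : qk.imK = 1 := rfl

theorem qi_mul_qi : qi * qi = -1 := by apply Quaternion.ext <;> simp <;> rfl
theorem qj_mul_qj : qj * qj = -1 := by apply Quaternion.ext <;> simp <;> rfl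
theorem qk_mul_qk : qk * qk = -1 := by apply Quaternion.ext <;> simp <;> rfl
theorem qi_mul_qj : qi * qj = qk := by apply Quaternion.ext <;> simp
theorem qj_mul_qi : qj * qi = -qk := by apply Quaternion.ext <;> simp
theorem qj_mul_qk : qj * qk = qi := by apply Quaternion.ext <;> simp
theorem qk_mul_qj : qk * qj = -qi := by apply Quaternion.ext <;> simp
theorem qk_mul_qi : qk * qi = qj := by apply Quaternion.ext <;> simp
theorem qi_mul_qk : qi * qk = -qj := by apply Quaternion.ext <;> simp
theorem star_qi : star qi = -qi := by apply Quaternion.ext <;> simp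
theorem star_qj : star qj = -qj := by apply Quaternion.ext <;> simp
theorem star_qk : star qk = -qk := by apply Quaternion.ext <;> simp

theorem eq_sum_units (q : ℍ) :
    q = algebraMap ℝ ℍ q.re + q.imI • qi + q.imJ • qj + q.imK • qk := by
  apply Quaternion.ext <;> simp [Quaternion.algebraMap_def]

theorem coeComplex_eq (z : ℂ) : (z : ℍ) = algebraMap ℝ ℍ z.re + z.im • qi := by
  apply Quaternion.ext <;> simp [Quaternion.algebraMap_def]

set_option linter.unusedSectionVars false

section Module

variable {A : Type*} [AddCommGroup A] [Module ℝ A] [Module ℍ A] [Module ℍᵐᵒᵖ A]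

/-- An element on which left and right multiplication by quaternions agree. -/
def IsCentral (a : A) : Prop := ∀ q : ℍ, q • a = op q • a

/-- Four times the projection onto the central elements. -/
noncomputable def preProj (a : A) : A := a - qi • op qi • a - qj • op qj • a - qk • op qk • a

/-- The projection onto the central elements. -/
noncomputable def proj (a : A) : A := (1 / 4 : ℝ) • preProj a

theorem proj_add (a b : A) : proj (a + b) = proj a + proj b := by
  simp only [proj, preProj, smul_add, smul_sub]; abel

variable [IsScalarTower ℝ ℍ A] [IsScalarTower ℝ ℍᵐᵒᵖ A]

theorem op_algebraMap_smul (r : ℝ) (a : A) : op (algebraMap ℝ ℍ r) • a = r • a :=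
  algebraMap_smul ℍᵐᵒᵖ r a

theorem op_real_smul (r : ℝ) (q : ℍ) (a : A) : op (r • q) • a = r • op q • a := by
  rw [op_smul, smul_assoc]

theorem isCentral_of_units {a : A} (hi : qi • a = op qi • a) (hj : qj • a = op qj • a)
    (hk : qk • a = op qk • a) : IsCentral a := fun q => by
  rw [eq_sum_units q]
  simp only [add_smul, op_add, algebraMap_smul, smul_assoc, op_algebraMap_smul, op_real_smul,
    hi, hj, hk]

theorem op_coeComplex_smul {a : A} (hi : qi • a = op qi • a) (z : ℂ) :
    op (z : ℍ) • a = (z : ℍ) • a := by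
  rw [coeComplex_eq]
  simp only [add_smul, op_add, algebraMap_smul, smul_assoc, op_algebraMap_smul, op_real_smul, hi]

variable [SMulCommClass ℍ ℍᵐᵒᵖ A]

theorem op_smul_smul_comm (p q : ℍ) (a : A) : op p • q • a = q • op p • a :=
  (smul_comm q (op p) a).symm

theorem proj_smul {a : A} (ha : IsCentral a) (q : ℍ) : proj (q • a) = q.re • a := by
  have h (e : ℍ) : e • op e • q • a = (e * q * e) • a := by
    rw [op_smul_smul_comm, ← ha e, smul_smul, smul_smul, mul_assoc]
  rw [proj, preProj, h, h, h, ← sub_smul, ← sub_smul, ← sub_smul,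
    show q - qi * q * qi - qj * q * qj - qk * q * qk = algebraMap ℝ ℍ (4 * q.re) by
      apply Quaternion.ext <;> simp [Quaternion.algebraMap_def]; ring,
    algebraMap_smul, smul_smul]
  congr 1; ring

theorem proj_of_isCentral {a : A} (ha : IsCentral a) : proj a = a := by
  have h := proj_smul ha 1
  rwa [one_smul, Quaternion.re_one, one_smul] at h

theorem isCentral_proj (a : A) : IsCentral (proj a) := by
  have key : IsCentral (preProj a) := by
    apply isCentral_of_units <;>
    · simp only [preProj, smul_sub, op_smul_smul_comm]
      simp only [smul_smul, ← op_mul, qi_mul_qi, qj_mul_qj, qk_mul_qk, qi_mul_qj, qj_mul_qi,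
        qj_mul_qk, qk_mul_qj, qk_mul_qi, qi_mul_qk, op_neg, op_one, neg_smul, one_smul, smul_neg]
      abel
  intro q
  rw [proj, smul_comm q, smul_comm (op q), key q]

theorem eq_sum_proj (a : A) : a = proj a + qi • proj (-qi • a) + qj • proj (-qj • a) +
    qk • proj (-qk • a) := by
  have key : preProj a + qi • preProj (-qi • a) + qj • preProj (-qj • a) +
      qk • preProj (-qk • a) = (4 : ℝ) • a := by
    have h4 : (4 : ℝ) • a = a + a + a + a := by module
    rw [h4]
    simp only [preProj, smul_sub, op_smul_smul_comm, neg_smul, smul_neg]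
    simp only [smul_smul, qi_mul_qi, qj_mul_qj, qk_mul_qk, qi_mul_qj, qj_mul_qi,
        qj_mul_qk, qk_mul_qj, qk_mul_qi, qi_mul_qk, neg_smul, smul_neg, one_smul,
        neg_neg]
    abel
  simp only [proj, smul_comm _ (1 / 4 : ℝ), ← smul_add]
  rw [key, smul_smul]
  norm_num

/-- Every element is a sum of quaternion multiples of central elements. -/
theorem induction_on {p : A → Prop} (hadd : ∀ a b, p a → p b → p (a + b))
    (hsmul : ∀ (q : ℍ) (x : A), IsCentral x → p (q • x)) (a : A) : p a := by
  rw [eq_sum_proj a, ← one_smul ℍ (proj a)]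
  exact hadd _ _ (hadd _ _ (hadd _ _ (hsmul _ _ (isCentral_proj _)) (hsmul _ _ (isCentral_proj _)))
    (hsmul _ _ (isCentral_proj _))) (hsmul _ _ (isCentral_proj _))

end Module

section Algebra

universe u

variable {A : Type u} [NonUnitalNormedRing A] [StarRing A] [NormedSpace ℝ A]
  [IsScalarTower ℝ A A] [SMulCommClass ℝ A A] [StarModule ℝ A] [CompleteSpace A] [CStarRing A]
  [Module ℍ A] [Module ℍᵐᵒᵖ A] [IsScalarTower ℝ ℍ A] [IsScalarTower ℝ ℍᵐᵒᵖ A]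
  [SMulCommClass ℍ ℍᵐᵒᵖ A] [IsNormalQuaternionBStarAlgebra A]

open IsNormalQuaternionBStarAlgebra

theorem norm_smul_le' (q : ℍ) (a : A) : ‖q • a‖ ≤ ‖q‖ * ‖a‖ := by
  simpa using norm_smul_op_smul_le q 1 a

theorem norm_op_smul_le (q : ℍ) (a : A) : ‖op q • a‖ ≤ ‖q‖ * ‖a‖ := by
  simpa [mul_comm] using norm_smul_op_smul_le 1 q a

theorem continuous_smul_left (q : ℍ) : Continuous fun a : A => q • a :=
  AddMonoidHomClass.continuous_of_bound (DistribSMul.toAddMonoidHom A q) ‖q‖ (norm_smul_le' q)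

theorem continuous_op_smul (q : ℍ) : Continuous fun a : A => op q • a :=
  AddMonoidHomClass.continuous_of_bound (DistribSMul.toAddMonoidHom A (op q)) ‖q‖
    (norm_op_smul_le q)

theorem star_smul_qi {a : A} (ha : qi • a = op qi • a) : qi • star a = op qi • star a := by
  have h := congrArg star ha
  simpa only [star_quat_smul, star_op_quat_smul, star_qi, op_neg, neg_smul, neg_inj,
    eq_comm] using h

theorem IsCentral.star {a : A} (ha : IsCentral a) : IsCentral (star a) := fun q => by
  have h := congrArg Star.star (ha (Star.star q))
  rw [star_quat_smul, star_op_quat_smul, star_star] at h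
  exact h.symm

theorem IsCentral.mul {a b : A} (ha : IsCentral a) (hb : IsCentral b) : IsCentral (a * b) :=
  fun q => by rw [op_quat_smul_mul', ← hb q, ← op_quat_smul_mul, ← ha q, quat_smul_mul]

theorem IsCentral.smul_mul_smul {x y : A} (hx : IsCentral x) (q r : ℍ) :
    (q • x) * (r • y) = (q * r) • (x * y) := by
  rw [quat_smul_mul, ← op_quat_smul_mul, ← hx r, quat_smul_mul, smul_smul]

/-- Linearized normality. -/
theorem star_mul_add_star_mul (a b : A) : star a * b + star b * a = a * star b + b * star a := by
  have h := star_mul_self_comm (a + b)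
  simp only [star_add, add_mul, mul_add] at h
  have ha := star_mul_self_comm a
  have hb := star_mul_self_comm b
  rw [ha, hb] at h
  have : (a * star a + star b * a + (star a * b + b * star b)) - a * star a - b * star b
    = (a * star a + b * star a + (a * star b + b * star b)) - a * star a - b * star b := by rw [h]
  convert this using 1 <;> abel

theorem star_mul_eq_mul_star {a b : A} (ha : qi • a = op qi • a) (hb : qi • b = op qi • b) :
    star a * b = b * star a := by
  have e1 := star_mul_add_star_mul a b
  have e2 := star_mul_add_star_mul a (qi • b)
  have hsa := star_smul_qi ha
  have hsb := star_smul_qi hb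
  rw [star_quat_smul, star_qi, op_neg, neg_smul, ← hsb, ← op_quat_smul_mul, ← hsa, quat_smul_mul,
    neg_mul, mul_neg, quat_smul_mul, quat_smul_mul, ← op_quat_smul_mul, ← ha, quat_smul_mul] at e2
  have e3 := congrArg (fun x => -qi • x) e2
  simp only [smul_add, smul_neg, smul_smul, neg_mul, qi_mul_qi, one_smul, neg_neg] at e3
  have e4 : (2 : ℝ) • (star a * b) = (2 : ℝ) • (b * star a) := by
    have : (star a * b + star b * a) + (star a * b + -(star b * a)) =
      (a * star b + b * star a) + (-(a * star b) + b * star a) := by rw [e1, e3]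
    convert this using 1 <;> module
  exact smul_right_injective A (two_ne_zero' ℝ) e4

theorem mul_comm_of_qi {a b : A} (ha : qi • a = op qi • a) (hb : qi • b = op qi • b) :
    a * b = b * a := by
  simpa using star_mul_eq_mul_star (star_smul_qi ha) hb

theorem IsCentral.star_mul_comm {b c : A} (hb : IsCentral b) (hc : IsCentral c) :
    Star.star c * b = Star.star b * c := by
  have e := star_mul_add_star_mul (qi • b) (qj • c)
  simp only [star_quat_smul, ← hb.star _, ← hc.star _] at e
  rw [hb.star.smul_mul_smul, hc.star.smul_mul_smul, hb.smul_mul_smul, hc.smul_mul_smul,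
    star_qi, star_qj, neg_mul, neg_mul, mul_neg, mul_neg, qi_mul_qj, qj_mul_qi,
    ← star_mul_eq_mul_star (hb qi) (hc qi), ← star_mul_eq_mul_star (hc qi) (hb qi)] at e
  have e3 := congrArg (fun x => qk • x) e
  simp only [smul_add, neg_smul, smul_neg, smul_smul, qk_mul_qk, one_smul, neg_neg] at e3
  have e4 : (2 : ℝ) • (Star.star c * b) = (2 : ℝ) • (Star.star b * c) := by
    have h := congrArg (fun x => (Star.star c * b + Star.star b * c) + x) e3.symm
    convert h using 1 <;> module
  exact smul_right_injective A (two_ne_zero' ℝ) e4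

theorem IsCentral.isSelfAdjoint {a : A} (ha : IsCentral a) : IsSelfAdjoint a := by
  set s := a - Star.star a with hs
  have hsc : IsCentral s := fun q => by rw [hs, smul_sub, smul_sub, ha q, ha.star q]
  have hss : Star.star s = -s := by rw [hs, star_sub, star_star, neg_sub]
  have h := hsc.star_mul_comm (hsc.mul hsc)
  rw [star_mul, hss, neg_mul_neg, neg_mul, ← mul_assoc] at h
  replace h : s * s * s = 0 := by
    refine smul_right_injective A (two_ne_zero' ℝ) ?_
    change (2 : ℝ) • (s * s * s) = (2 : ℝ) • (0 : A)
    rw [two_smul, smul_zero]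
    nth_rw 1 [h]
    exact neg_add_cancel _
  have h2 : s * s = 0 := by
    rw [← CStarRing.star_mul_self_eq_zero_iff, star_mul, hss, neg_mul_neg, ← mul_assoc, h, zero_mul]
  have h3 : s = 0 := by
    rw [← CStarRing.star_mul_self_eq_zero_iff, hss, neg_mul, h2, neg_zero]
  exact (sub_eq_zero.1 h3).symm

theorem IsCentral.star_smul {x : A} (hx : IsCentral x) (q : ℍ) :
    Star.star (q • x) = Star.star q • x := by
  rw [star_quat_smul, hx.isSelfAdjoint.star_eq, hx]

theorem isCentral_of_isSelfAdjoint {a : A} (ha : IsSelfAdjoint a) : IsCentral a := by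
  have h : (2 : ℝ) • a = (2 : ℝ) • proj a := by
    have h1 : a + star a = (2 : ℝ) • proj a := by
      conv_lhs => rw [eq_sum_proj a]
      simp only [star_add, (isCentral_proj _).star_smul, (isCentral_proj _).isSelfAdjoint.star_eq,
        star_qi, star_qj, star_qk, neg_smul, two_smul]
      abel
    rw [← h1, ha.star_eq, two_smul]
  rw [smul_right_injective A (two_ne_zero' ℝ) h]
  exact isCentral_proj a

variable (A) in
/-- The elements commuting with the quaternion unit `i`: a commutative complex C⋆-algebra. -/
def complexPart : NonUnitalStarSubalgebra ℝ A where
  carrier := {a | qi • a = op qi • a}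
  add_mem' {a b} (ha : _ = _) (hb : _ = _) := by
    rw [Set.mem_ofPred_eq, smul_add, smul_add, ha, hb]
  zero_mem' := by rw [Set.mem_ofPred_eq, smul_zero, smul_zero]
  mul_mem' {a b} (ha : _ = _) (hb : _ = _) := by
    rw [Set.mem_ofPred_eq, op_quat_smul_mul', ← hb, ← op_quat_smul_mul, ← ha, quat_smul_mul]
  smul_mem' r a (ha : _ = _) := by
    rw [Set.mem_ofPred_eq, smul_comm qi, smul_comm (op qi), ha]
  star_mem' {a} (ha : _ = _) := star_smul_qi ha

theorem mem_complexPart {a : A} : a ∈ complexPart A ↔ qi • a = op qi • a := Iff.rfl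

theorem isClosed_complexPart : IsClosed (complexPart A : Set A) :=
  isClosed_eq (continuous_smul_left qi) (continuous_op_smul qi)

theorem coeComplex_smul_mem (z : ℂ) {a : A} (ha : a ∈ complexPart A) :
    (z : ℍ) • a ∈ complexPart A := by
  rw [mem_complexPart] at ha ⊢
  rw [op_smul_smul_comm, ← ha, smul_smul, smul_smul]
  congr 1
  apply Quaternion.ext <;> simp

noncomputable instance : Module ℂ (complexPart A) where
  smul z a := ⟨(z : ℍ) • (a : A), coeComplex_smul_mem z a.2⟩
  one_smul a := Subtype.ext (by
    change ((1 : ℂ) : ℍ) • (a : A) = a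
    rw [Quaternion.coeComplex_one, one_smul])
  mul_smul z w a := Subtype.ext (by
    change ((z * w : ℂ) : ℍ) • (a : A) = (z : ℍ) • (w : ℍ) • (a : A)
    rw [Quaternion.coeComplex_mul, mul_smul])
  smul_zero z := Subtype.ext (smul_zero (z : ℍ))
  smul_add z a b := Subtype.ext (smul_add (z : ℍ) (a : A) b)
  add_smul z w a := Subtype.ext (by
    change ((z + w : ℂ) : ℍ) • (a : A) = (z : ℍ) • (a : A) + (w : ℍ) • (a : A)
    rw [Quaternion.coeComplex_add, add_smul])
  zero_smul a := Subtype.ext (by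
    change ((0 : ℂ) : ℍ) • (a : A) = 0
    rw [Quaternion.coeComplex_zero, zero_smul])

theorem coe_complex_smul (z : ℂ) (a : complexPart A) :
    ((z • a : complexPart A) : A) = (z : ℍ) • (a : A) := rfl

noncomputable instance : NonUnitalCommCStarAlgebra (complexPart A) where
  toCompleteSpace := isClosed_complexPart.completeSpace_coe
  norm_mul_self_le x := (CStarRing.norm_star_mul_self (x := (x : A))).symm.le
  mul_comm a b := Subtype.ext (mul_comm_of_qi a.2 b.2)
  norm_smul_le z a := by
    refine (norm_smul_le' (z : ℍ) (a : A)).trans_eq ?_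
    congr 1
    rw [← sq_eq_sq₀ (norm_nonneg _) (norm_nonneg _), sq, ← Quaternion.normSq_eq_norm_mul_self,
      ← Complex.normSq_eq_norm_sq, Quaternion.normSq_def', Complex.normSq_apply]
    simp [sq]
  smul_assoc z a b := Subtype.ext (quat_smul_mul (z : ℍ) (a : A) (b : A))
  smul_comm z a b := Subtype.ext (by
    change (z : ℍ) • ((a : A) * b) = a * ((z : ℍ) • (b : A))
    rw [← op_quat_smul_mul, op_coeComplex_smul a.2, quat_smul_mul])
  star_smul z a := Subtype.ext (by
    change star ((z : ℍ) • (a : A)) = ((star z : ℂ) : ℍ) • star (a : A)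
    rw [star_quat_smul, ← op_coeComplex_smul (star_smul_qi a.2)]
    congr 2
    apply Quaternion.ext <;> simp)

variable (A) in
/-- The central elements form the algebra of real functions vanishing at infinity on some locally
compact Hausdorff space. -/
theorem exists_real_gelfand :
    ∃ (Ω : Type u) (_ : TopologicalSpace Ω) (_ : LocallyCompactSpace Ω) (_ : T2Space Ω)
      (ρ : A → C₀(Ω, ℝ)),
      (∀ a b, ρ (a + b) = ρ a + ρ b) ∧
      (∀ (q : ℍ) (x : A), IsCentral x → ρ (q • x) = q.re • ρ x) ∧
      (∀ x y, IsCentral x → IsCentral y → ρ (x * y) = ρ x * ρ y) ∧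
      (∀ x, IsCentral x → ‖ρ x‖ = ‖x‖) ∧
      (∀ f, ∃ x, IsCentral x ∧ ρ x = f) := by
  obtain ⟨Ω, _, _, _, Ψ, hsurj, hnorm⟩ :=
    NonUnitalCommCStarAlgebra.exists_gelfand_isometry (complexPart A)
  let c (x : A) (hx : IsCentral x) : complexPart A := ⟨x, hx qi⟩
  have hΨreal (x : A) (hx : IsCentral x) (ω : Ω) : ((Ψ (c x hx) ω).re : ℂ) = Ψ (c x hx) ω := by
    have h : star (c x hx) = c x hx := Subtype.ext hx.isSelfAdjoint.star_eq
    rw [← Complex.conj_eq_iff_re]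
    conv_rhs => rw [← h, map_star]
    rfl
  let ρ (a : A) : C₀(Ω, ℝ) := .postcomp ⟨Complex.re, Complex.continuous_re⟩ Complex.zero_re
    (Ψ (c (proj a) (isCentral_proj a)))
  have hρ (x : A) (hx : IsCentral x) (ω : Ω) : (ρ x ω : ℂ) = Ψ (c x hx) ω := by
    rw [← hΨreal]
    have : c (proj x) (isCentral_proj x) = c x hx := Subtype.ext (proj_of_isCentral hx)
    change ((Ψ (c (proj x) (isCentral_proj x)) ω).re : ℂ) = _
    rw [this]
  refine ⟨Ω, inferInstance, inferInstance, inferInstance, ρ, fun a b => ?_, fun q x hx => ?_,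
    fun x y hx hy => ?_, fun x hx => ?_, fun f => ?_⟩
  · ext ω
    have : c (proj (a + b)) (isCentral_proj _) =
      c (proj a) (isCentral_proj _) + c (proj b) (isCentral_proj _) := Subtype.ext (proj_add a b)
    change (Ψ _ ω).re = (Ψ _ ω).re + (Ψ _ ω).re
    rw [this, map_add, ZeroAtInftyContinuousMap.add_apply, Complex.add_re]
  · ext ω
    have : c (proj (q • x)) (isCentral_proj _) = (q.re : ℂ) • c x hx := Subtype.ext (by
      rw [coe_complex_smul, Quaternion.coeComplex_coe]
      exact (proj_smul hx q).trans (algebraMap_smul ℍ q.re x).symm)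
    rw [ZeroAtInftyContinuousMap.smul_apply, smul_eq_mul, ← Complex.ofReal_inj,
      Complex.ofReal_mul, hρ x hx, ← smul_eq_mul, ← ZeroAtInftyContinuousMap.smul_apply, ← map_smul,
      ← this]
    exact hΨreal _ _ ω
  · ext ω
    rw [ZeroAtInftyContinuousMap.mul_apply, ← Complex.ofReal_inj, Complex.ofReal_mul, hρ x hx,
      hρ y hy, hρ _ (hx.mul hy), ← ZeroAtInftyContinuousMap.mul_apply, ← map_mul]
    rfl
  · refine Eq.trans (ZeroAtInftyContinuousMap.norm_eq_norm_of_forall fun ω => ?_) (hnorm (c x hx))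
    rw [← hρ x hx, Complex.norm_real]
  · obtain ⟨b, hb⟩ := hsurj (.postcomp ⟨Complex.ofReal, Complex.continuous_ofReal⟩
      Complex.ofReal_zero f)
    have hsa : star b = b := by
      have hinj : Function.Injective Ψ := by
        rw [injective_iff_map_eq_zero]
        intro d hd
        rw [← norm_eq_zero, ← hnorm, hd, norm_zero]
      apply hinj
      rw [map_star, hb]
      ext ω
      exact Complex.conj_ofReal _
    have hbc : IsCentral (b : A) := isCentral_of_isSelfAdjoint (congrArg Subtype.val hsa)
    refine ⟨b, hbc, ?_⟩
    ext ω
    rw [← Complex.ofReal_inj, hρ _ hbc]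
    exact DFunLike.congr_fun hb ω

/-- The function `ω ↦ f ω • q`. -/
noncomputable def smulConst {Ω : Type*} [TopologicalSpace Ω] (f : C₀(Ω, ℝ)) (q : ℍ) : C₀(Ω, ℍ) :=
  f.postcomp ⟨fun r => r • q, by fun_prop⟩ (zero_smul ℝ q)

theorem smulConst_apply {Ω : Type*} [TopologicalSpace Ω] (f : C₀(Ω, ℝ)) (q : ℍ) (ω : Ω) :
    smulConst f q ω = f ω • q := rfl

theorem eq_sum_smulConst {Ω : Type*} [TopologicalSpace Ω] (F : C₀(Ω, ℍ)) :
    ∃ f₀ f₁ f₂ f₃ : C₀(Ω, ℝ),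
      F = smulConst f₀ 1 + smulConst f₁ qi + smulConst f₂ qj + smulConst f₃ qk := by
  refine ⟨F.postcomp ⟨_, Quaternion.continuous_re⟩ rfl,
    F.postcomp ⟨_, Quaternion.continuous_imI⟩ rfl, F.postcomp ⟨_, Quaternion.continuous_imJ⟩ rfl,
    F.postcomp ⟨_, Quaternion.continuous_imK⟩ rfl, ?_⟩
  ext ω : 1
  refine (eq_sum_units (F ω)).trans ?_
  rw [Algebra.algebraMap_eq_smul_one]
  rfl

variable (A) in
/-- The Gelfand theorem for normal `ℍ`-B⋆-algebras. -/
theorem exists_gelfand :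
    ∃ (Ω : Type u) (_ : TopologicalSpace Ω) (_ : LocallyCompactSpace Ω) (_ : T2Space Ω)
      (Φ : A → C₀(Ω, ℍ)),
      Function.Bijective Φ ∧
      (∀ a b : A, Φ (a + b) = Φ a + Φ b) ∧
      (∀ (r : ℝ) (a : A), Φ (r • a) = r • Φ a) ∧
      (∀ a b : A, Φ (a * b) = Φ a * Φ b) ∧
      (∀ a : A, ‖Φ a‖ = ‖a‖) ∧
      (∀ a : A, Φ (star a) = star (Φ a)) ∧
      (∀ (α β : ℍ) (a : A) (ω : Ω), Φ (α • op β • a) ω = α * Φ a ω * β) := by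
  obtain ⟨Ω, _, _, _, ρ, hadd, hsmul, hmul, hnorm, hsurj⟩ := exists_real_gelfand A
  let Φ (a : A) : C₀(Ω, ℍ) := smulConst (ρ a) 1 + smulConst (ρ (-qi • a)) qi +
    smulConst (ρ (-qj • a)) qj + smulConst (ρ (-qk • a)) qk
  have Φadd (a b : A) : Φ (a + b) = Φ a + Φ b := by
    ext ω : 1
    simp only [Φ, smul_add, hadd, ZeroAtInftyContinuousMap.add_apply, smulConst_apply, add_smul]
    abel
  have Φsmul (q : ℍ) (x : A) (hx : IsCentral x) : Φ (q • x) = smulConst (ρ x) q := by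
    ext ω : 1
    simp only [Φ, smul_smul, hsmul _ x hx, ZeroAtInftyContinuousMap.add_apply, smulConst_apply,
      ZeroAtInftyContinuousMap.smul_apply]
    apply Quaternion.ext <;>
      simp [mul_comm, Quaternion.re_one, Quaternion.imI_one, Quaternion.imJ_one, Quaternion.imK_one]
  clear_value Φ
  have Φbimul (α β : ℍ) (a : A) (ω : Ω) : Φ (α • op β • a) ω = α * Φ a ω * β := by
    induction a using induction_on with
    | hadd a b ha hb =>
      rw [smul_add, smul_add, Φadd, Φadd, ZeroAtInftyContinuousMap.add_apply, ha, hb,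
        ZeroAtInftyContinuousMap.add_apply, mul_add, add_mul]
    | hsmul q x hx =>
      rw [op_smul_smul_comm, ← hx β, smul_smul, smul_smul, Φsmul _ x hx, Φsmul _ x hx,
        smulConst_apply, smulConst_apply, mul_smul_comm, smul_mul_assoc, mul_assoc]
  have Φmul (a b : A) : Φ (a * b) = Φ a * Φ b := by
    induction a using induction_on with
    | hadd a a' ha ha' => rw [add_mul, Φadd, Φadd, ha, ha', add_mul]
    | hsmul q x hx =>
      induction b using induction_on with
      | hadd b b' hb hb' => rw [mul_add, Φadd, Φadd, hb, hb', mul_add]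
      | hsmul r y hy =>
        ext ω : 1
        rw [hx.smul_mul_smul, Φsmul _ _ (hx.mul hy), Φsmul _ x hx, Φsmul _ y hy,
          ZeroAtInftyContinuousMap.mul_apply, smulConst_apply, smulConst_apply, smulConst_apply,
          smul_mul_smul_comm, hmul x y hx hy, ZeroAtInftyContinuousMap.mul_apply]
  have Φstar (a : A) : Φ (star a) = star (Φ a) := by
    induction a using induction_on with
    | hadd a b ha hb => rw [star_add, Φadd, Φadd, ha, hb, star_add]
    | hsmul q x hx =>
      ext ω : 1
      rw [hx.star_smul, Φsmul _ x hx, Φsmul _ x hx, ZeroAtInftyContinuousMap.star_apply,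
        smulConst_apply, smulConst_apply, Quaternion.star_smul]
  have Φnorm (a : A) : ‖Φ a‖ = ‖a‖ := by
    have hc : IsCentral (star a * a) := isCentral_of_isSelfAdjoint (.star_mul_self a)
    rw [← mul_self_inj (norm_nonneg _) (norm_nonneg _), ← CStarRing.norm_star_mul_self,
      ← CStarRing.norm_star_mul_self, ← Φstar, ← Φmul, ← hnorm _ hc,
      ← one_smul ℍ (star a * a), Φsmul _ _ hc, one_smul]
    refine ZeroAtInftyContinuousMap.norm_eq_norm_of_forall fun ω => ?_
    rw [smulConst_apply, norm_smul, norm_one, mul_one]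
  refine ⟨Ω, inferInstance, inferInstance, inferInstance, Φ, ⟨fun a b hab => ?_, fun F => ?_⟩,
    Φadd, fun r a => ?_, Φmul, Φnorm, Φstar, Φbimul⟩
  · have h : Φ (a - b) = 0 := by
      rw [← add_eq_right (b := Φ b), ← Φadd, sub_add_cancel, hab]
    rw [← sub_eq_zero, ← norm_eq_zero, ← Φnorm, h, norm_zero]
  · obtain ⟨f₀, f₁, f₂, f₃, rfl⟩ := eq_sum_smulConst F
    obtain ⟨x₀, h₀, rfl⟩ := hsurj f₀
    obtain ⟨x₁, h₁, rfl⟩ := hsurj f₁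
    obtain ⟨x₂, h₂, rfl⟩ := hsurj f₂
    obtain ⟨x₃, h₃, rfl⟩ := hsurj f₃
    refine ⟨(1 : ℍ) • x₀ + qi • x₁ + qj • x₂ + qk • x₃, ?_⟩
    rw [Φadd, Φadd, Φadd, Φsmul _ _ h₀, Φsmul _ _ h₁, Φsmul _ _ h₂, Φsmul _ _ h₃]
  · ext ω : 1
    have h := Φbimul (algebraMap ℝ ℍ r) 1 a ω
    rwa [op_one, one_smul, algebraMap_smul, mul_one, ← Algebra.smul_def] at h

end Algebra

end QuaternionBStar

theorem stmt18.{u} (A : Type u) [NonUnitalNormedRing A] [StarRing A] [NormedSpace ℝ A]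
    [IsScalarTower ℝ A A] [SMulCommClass ℝ A A] [StarModule ℝ A]
    [CompleteSpace A] [CStarRing A]
    [Module ℍ A] [Module ℍᵐᵒᵖ A] [IsScalarTower ℝ ℍ A] [IsScalarTower ℝ ℍᵐᵒᵖ A]
    [SMulCommClass ℍ ℍᵐᵒᵖ A]
    (hnb : ∀ (α β : ℍ) (a : A), ‖α • op β • a‖ ≤ ‖α‖ * ‖a‖ * ‖β‖)
    (h1 : ∀ (γ : ℍ) (a b : A), (γ • a) * b = γ • (a * b))
    (h2 : ∀ (γ : ℍ) (a b : A), (op γ • a) * b = a * (γ • b))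
    (h3 : ∀ (γ : ℍ) (a b : A), op γ • (a * b) = a * (op γ • b))
    (h4 : ∀ (α : ℍ) (b : A), star (α • b) = op (star α) • (star b))
    (h5 : ∀ (α : ℍ) (b : A), star (op α • b) = (star α) • (star b))
    (hnormal : ∀ a : A, star a * a = a * star a) :
    ∃ (Ω : Type u) (_ : TopologicalSpace Ω) (_ : LocallyCompactSpace Ω) (_ : T2Space Ω)
      (Φ : A → C₀(Ω, ℍ)),
      Function.Bijective Φ ∧
      (∀ a b : A, Φ (a + b) = Φ a + Φ b) ∧
      (∀ (r : ℝ) (a : A), Φ (r • a) = r • Φ a) ∧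
      (∀ a b : A, Φ (a * b) = Φ a * Φ b) ∧
      (∀ a : A, ‖Φ a‖ = ‖a‖) ∧
      (∀ a : A, Φ (star a) = star (Φ a)) ∧
      (∀ (α β : ℍ) (a : A) (ω : Ω), Φ (α • op β • a) ω = α * Φ a ω * β) := by
  have : IsNormalQuaternionBStarAlgebra A := ⟨hnb, h1, h2, h3, h4, h5, hnormal⟩
  exact QuaternionBStar.exists_gelfand A
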